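/- (Lolli admits uniform provability.) A Lolli sequent Γ;Δ ⊢ G has a proof in Lolli if and only if it has a uniform proof, where a uniform proof is a Lolli proof in which every sequent occurring in it whose goal formula is non-atomic is the conclusion of the right-introduction rule for the top-level logical symbol of that goal formula. -/

import Mathlib

/- The language of Lolli.  `α` is the type of atomic formulas and `T` is the
type of first-order terms; quantification is represented in higher-order
abstract syntax over `T`, so that the substitution `B[t/x]` appearing in the
∀L and ∃R rules is function application, and the eigenvariable condition of
∀R is expressed by quantifying over all terms. -/
mutual

/-- Program clause formulas: `P ::= A | P & P | G ⊸ P | G ⇒ P | ∀x.P`. -/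
inductive PF (α T : Type) : Type
  | atom : α → PF α T
  | conj : PF α T → PF α T → PF α T
  | limp : GF α T → PF α T → PF α T     -- `G ⊸ P`
  | imp  : GF α T → PF α T → PF α T     -- `G ⇒ P`
  | all  : (T → PF α T) → PF α T

/-- Goal formulas:
`G ::= ⊤ | A | G & G | P ⊸ G | P ⇒ G | ∀x.G | ∃x.G | !G | G ⊗ G | G ⊕ G`. -/
inductive GF (α T : Type) : Type
  | top  : GF α T
  | atom : α → GF α T
  | conj : GF α T → GF α T → GF α T
  | limp : PF α T → GF α T → GF α T     -- `P ⊸ G`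
  | imp  : PF α T → GF α T → GF α T     -- `P ⇒ G`
  | all  : (T → GF α T) → GF α T
  | ex   : (T → GF α T) → GF α T
  | bang : GF α T → GF α T
  | tensor : GF α T → GF α T → GF α T
  | oplus  : GF α T → GF α T → GF α T

end

/-- Proof trees for Lolli sequents, represented as data so that properties of
the *shape* of a proof (uniformity, markedness, etc.) can be expressed.  Each
constructor is one inference rule of Lolli; principal formulas are explicit
arguments. -/
inductive Proof {α T : Type} : Set (PF α T) → Multiset (PF α T) → GF α T → Type
  | id (Γ : Set (PF α T)) (a : α) : Proof Γ {PF.atom a} (GF.atom a)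
  | absorb {Γ Δ G} (B : PF α T) : B ∈ Γ → Proof Γ (B ::ₘ Δ) G → Proof Γ Δ G
  | topR (Γ : Set (PF α T)) (Δ : Multiset (PF α T)) : Proof Γ Δ GF.top
  | conjL₁ {Γ Δ G} (B₁ B₂ : PF α T) :
      Proof Γ (B₁ ::ₘ Δ) G → Proof Γ (PF.conj B₁ B₂ ::ₘ Δ) G
  | conjL₂ {Γ Δ G} (B₁ B₂ : PF α T) :
      Proof Γ (B₂ ::ₘ Δ) G → Proof Γ (PF.conj B₁ B₂ ::ₘ Δ) G
  | conjR {Γ Δ} {G₁ G₂ : GF α T} :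
      Proof Γ Δ G₁ → Proof Γ Δ G₂ → Proof Γ Δ (GF.conj G₁ G₂)
  | limpL {Γ Δ₁ Δ₂ G} (G₁ : GF α T) (B₂ : PF α T) :
      Proof Γ Δ₁ G₁ → Proof Γ (B₂ ::ₘ Δ₂) G →
      Proof Γ (PF.limp G₁ B₂ ::ₘ (Δ₁ + Δ₂)) G
  | limpR {Γ Δ} {B : PF α T} {G : GF α T} :
      Proof Γ (B ::ₘ Δ) G → Proof Γ Δ (GF.limp B G)
  | impL {Γ Δ G} (G₁ : GF α T) (B₂ : PF α T) :
      Proof Γ 0 G₁ → Proof Γ (B₂ ::ₘ Δ) G → Proof Γ (PF.imp G₁ B₂ ::ₘ Δ) G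
  | impR {Γ Δ} {B : PF α T} {G : GF α T} :
      Proof (insert B Γ) Δ G → Proof Γ Δ (GF.imp B G)
  | allL {Γ Δ G} (B : T → PF α T) (t : T) :
      Proof Γ (B t ::ₘ Δ) G → Proof Γ (PF.all B ::ₘ Δ) G
  | allR {Γ Δ} {G : T → GF α T} :
      (∀ t : T, Proof Γ Δ (G t)) → Proof Γ Δ (GF.all G)
  | exR {Γ Δ} {G : T → GF α T} (t : T) : Proof Γ Δ (G t) → Proof Γ Δ (GF.ex G)
  | bangR {Γ} {G : GF α T} : Proof Γ 0 G → Proof Γ 0 (GF.bang G)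
  | oplusR₁ {Γ Δ} {G₁ G₂ : GF α T} : Proof Γ Δ G₁ → Proof Γ Δ (GF.oplus G₁ G₂)
  | oplusR₂ {Γ Δ} {G₁ G₂ : GF α T} : Proof Γ Δ G₂ → Proof Γ Δ (GF.oplus G₁ G₂)
  | tensorR {Γ Δ₁ Δ₂} {G₁ G₂ : GF α T} :
      Proof Γ Δ₁ G₁ → Proof Γ Δ₂ G₂ → Proof Γ (Δ₁ + Δ₂) (GF.tensor G₁ G₂)

/-- A goal formula is atomic if it is of the form `A`. -/
def AtomicGoal {α T : Type} : GF α T → Prop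
  | GF.atom _ => True
  | _ => False

/-- A proof is uniform if every sequent occurring in it whose goal formula is
non-atomic is the conclusion of the right-introduction rule for the top-level
logical symbol of that goal formula.  Equivalently (since each sequent in a
proof tree is the conclusion of exactly one rule instance, and each
right-introduction rule introduces the top-level symbol of its conclusion's
goal): the conclusion of every `id`, `absorb` and left-introduction rule
instance has an atomic goal, recursively throughout the proof. -/
def Uniform {α T : Type} : ∀ {Γ : Set (PF α T)} {Δ : Multiset (PF α T)}
    {G : GF α T}, Proof Γ Δ G → Prop
  | _, _, _, Proof.id _ _ => True
  | _, _, G, Proof.absorb _ _ p => AtomicGoal G ∧ Uniform p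
  | _, _, _, Proof.topR _ _ => True
  | _, _, G, Proof.conjL₁ _ _ p => AtomicGoal G ∧ Uniform p
  | _, _, G, Proof.conjL₂ _ _ p => AtomicGoal G ∧ Uniform p
  | _, _, _, Proof.conjR p q => Uniform p ∧ Uniform q
  | _, _, G, Proof.limpL _ _ p q => AtomicGoal G ∧ Uniform p ∧ Uniform q
  | _, _, _, Proof.limpR p => Uniform p
  | _, _, G, Proof.impL _ _ p q => AtomicGoal G ∧ Uniform p ∧ Uniform q
  | _, _, _, Proof.impR p => Uniform p
  | _, _, G, Proof.allL _ _ p => AtomicGoal G ∧ Uniform p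
  | _, _, _, Proof.allR p => ∀ t, Uniform (p t)
  | _, _, _, Proof.exR _ p => Uniform p
  | _, _, _, Proof.bangR p => Uniform p
  | _, _, _, Proof.oplusR₁ p => Uniform p
  | _, _, _, Proof.oplusR₂ p => Uniform p
  | _, _, _, Proof.tensorR p q => Uniform p ∧ Uniform q

/-- The sequent `Γ ; Δ ⊢ G` has a uniform proof. -/
def UniformlyProvable {α T : Type} (Γ : Set (PF α T)) (Δ : Multiset (PF α T)) (G : GF α T) :
    Prop :=
  ∃ p : Proof Γ Δ G, Uniform p

namespace UniformlyProvable

variable {α T : Type} {Γ : Set (PF α T)} {Δ Δ₁ Δ₂ : Multiset (PF α T)}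

theorem conj_iff {G₁ G₂ : GF α T} :
    UniformlyProvable Γ Δ (GF.conj G₁ G₂) ↔
      UniformlyProvable Γ Δ G₁ ∧ UniformlyProvable Γ Δ G₂ := by
  constructor
  · rintro ⟨p, hp⟩
    cases p <;> simp only [Uniform, AtomicGoal, false_and] at hp
    exact ⟨⟨_, hp.1⟩, ⟨_, hp.2⟩⟩
  · rintro ⟨⟨p, hp⟩, ⟨q, hq⟩⟩
    exact ⟨.conjR p q, by simpa only [Uniform] using ⟨hp, hq⟩⟩

theorem limp_iff {B : PF α T} {G : GF α T} :
    UniformlyProvable Γ Δ (GF.limp B G) ↔ UniformlyProvable Γ (B ::ₘ Δ) G := by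
  constructor
  · rintro ⟨p, hp⟩
    cases p <;> simp only [Uniform, AtomicGoal, false_and] at hp
    exact ⟨_, hp⟩
  · rintro ⟨p, hp⟩
    exact ⟨.limpR p, by simpa only [Uniform] using hp⟩

theorem imp_iff {B : PF α T} {G : GF α T} :
    UniformlyProvable Γ Δ (GF.imp B G) ↔ UniformlyProvable (insert B Γ) Δ G := by
  constructor
  · rintro ⟨p, hp⟩
    cases p <;> simp only [Uniform, AtomicGoal, false_and] at hp
    exact ⟨_, hp⟩
  · rintro ⟨p, hp⟩
    exact ⟨.impR p, by simpa only [Uniform] using hp⟩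

theorem all_iff {G : T → GF α T} :
    UniformlyProvable Γ Δ (GF.all G) ↔ ∀ t, UniformlyProvable Γ Δ (G t) := by
  constructor
  · rintro ⟨p, hp⟩
    cases p <;> simp only [Uniform, AtomicGoal, false_and] at hp
    exact fun t => ⟨_, hp t⟩
  · intro h
    choose p hp using h
    exact ⟨.allR p, by simpa only [Uniform] using hp⟩

theorem ex_iff {G : T → GF α T} :
    UniformlyProvable Γ Δ (GF.ex G) ↔ ∃ t, UniformlyProvable Γ Δ (G t) := by
  constructor
  · rintro ⟨p, hp⟩
    cases p <;> simp only [Uniform, AtomicGoal, false_and] at hp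
    exact ⟨_, _, hp⟩
  · rintro ⟨t, p, hp⟩
    exact ⟨.exR t p, by simpa only [Uniform] using hp⟩

theorem bang_iff {G : GF α T} :
    UniformlyProvable Γ Δ (GF.bang G) ↔ Δ = 0 ∧ UniformlyProvable Γ 0 G := by
  constructor
  · rintro ⟨p, hp⟩
    cases p <;> simp only [Uniform, AtomicGoal, false_and] at hp
    exact ⟨rfl, _, hp⟩
  · rintro ⟨rfl, p, hp⟩
    exact ⟨.bangR p, by simpa only [Uniform] using hp⟩

theorem oplus_iff {G₁ G₂ : GF α T} :
    UniformlyProvable Γ Δ (GF.oplus G₁ G₂) ↔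
      UniformlyProvable Γ Δ G₁ ∨ UniformlyProvable Γ Δ G₂ := by
  constructor
  · rintro ⟨p, hp⟩
    cases p <;> simp only [Uniform, AtomicGoal, false_and] at hp
    · exact .inl ⟨_, hp⟩
    · exact .inr ⟨_, hp⟩
  · rintro (⟨p, hp⟩ | ⟨p, hp⟩)
    · exact ⟨.oplusR₁ p, by simpa only [Uniform] using hp⟩
    · exact ⟨.oplusR₂ p, by simpa only [Uniform] using hp⟩

theorem tensor_iff {G₁ G₂ : GF α T} :
    UniformlyProvable Γ Δ (GF.tensor G₁ G₂) ↔
      ∃ Δ₁ Δ₂, Δ = Δ₁ + Δ₂ ∧ UniformlyProvable Γ Δ₁ G₁ ∧ UniformlyProvable Γ Δ₂ G₂ := by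
  constructor
  · rintro ⟨p, hp⟩
    cases p <;> simp only [Uniform, AtomicGoal, false_and] at hp
    exact ⟨_, _, rfl, ⟨_, hp.1⟩, ⟨_, hp.2⟩⟩
  · rintro ⟨Δ₁, Δ₂, rfl, ⟨p, hp⟩, ⟨q, hq⟩⟩
    exact ⟨.tensorR p q, by simpa only [Uniform] using ⟨hp, hq⟩⟩

theorem top : UniformlyProvable Γ Δ GF.top :=
  ⟨.topR Γ Δ, by simp only [Uniform]⟩

theorem id (a : α) : UniformlyProvable Γ {PF.atom a} (GF.atom a) :=
  ⟨.id Γ a, by simp only [Uniform]⟩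

/-! Left rules with an atomic goal. -/

theorem absorb_of_atomic {G : GF α T} (hG : AtomicGoal G) {B : PF α T} (hB : B ∈ Γ) :
    UniformlyProvable Γ (B ::ₘ Δ) G → UniformlyProvable Γ Δ G := fun ⟨p, hp⟩ =>
  ⟨.absorb B hB p, by simpa only [Uniform] using ⟨hG, hp⟩⟩

theorem conjL₁_of_atomic {G : GF α T} (hG : AtomicGoal G) (B₁ B₂ : PF α T) :
    UniformlyProvable Γ (B₁ ::ₘ Δ) G → UniformlyProvable Γ (PF.conj B₁ B₂ ::ₘ Δ) G :=
  fun ⟨p, hp⟩ => ⟨.conjL₁ B₁ B₂ p, by simpa only [Uniform] using ⟨hG, hp⟩⟩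

theorem conjL₂_of_atomic {G : GF α T} (hG : AtomicGoal G) (B₁ B₂ : PF α T) :
    UniformlyProvable Γ (B₂ ::ₘ Δ) G → UniformlyProvable Γ (PF.conj B₁ B₂ ::ₘ Δ) G :=
  fun ⟨p, hp⟩ => ⟨.conjL₂ B₁ B₂ p, by simpa only [Uniform] using ⟨hG, hp⟩⟩

theorem limpL_of_atomic {G G₁ : GF α T} {B₂ : PF α T} (hG : AtomicGoal G) :
    UniformlyProvable Γ Δ₁ G₁ → UniformlyProvable Γ (B₂ ::ₘ Δ₂) G →
      UniformlyProvable Γ (PF.limp G₁ B₂ ::ₘ (Δ₁ + Δ₂)) G := fun ⟨p, hp⟩ ⟨q, hq⟩ =>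
  ⟨.limpL G₁ B₂ p q, by simpa only [Uniform] using ⟨hG, hp, hq⟩⟩

theorem impL_of_atomic {G G₁ : GF α T} {B₂ : PF α T} (hG : AtomicGoal G) :
    UniformlyProvable Γ 0 G₁ → UniformlyProvable Γ (B₂ ::ₘ Δ) G →
      UniformlyProvable Γ (PF.imp G₁ B₂ ::ₘ Δ) G := fun ⟨p, hp⟩ ⟨q, hq⟩ =>
  ⟨.impL G₁ B₂ p q, by simpa only [Uniform] using ⟨hG, hp, hq⟩⟩

theorem allL_of_atomic {G : GF α T} (hG : AtomicGoal G) (B : T → PF α T) (t : T) :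
    UniformlyProvable Γ (B t ::ₘ Δ) G → UniformlyProvable Γ (PF.all B ::ₘ Δ) G :=
  fun ⟨p, hp⟩ => ⟨.allL B t p, by simpa only [Uniform] using ⟨hG, hp⟩⟩

/-- Weakening of the unbounded context preserves uniform provability. -/
theorem weaken {G : GF α T} (h : UniformlyProvable Γ Δ G) {Γ' : Set (PF α T)} (hΓ : Γ ⊆ Γ') :
    UniformlyProvable Γ' Δ G := by
  obtain ⟨p, hp⟩ := h
  induction p generalizing Γ' <;> simp only [Uniform] at hp
  case id a => exact id a
  case absorb B hB _ ih => exact absorb_of_atomic hp.1 (hΓ hB) (ih hΓ hp.2)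
  case topR => exact top
  case conjL₁ ih => exact conjL₁_of_atomic hp.1 _ _ (ih hΓ hp.2)
  case conjL₂ ih => exact conjL₂_of_atomic hp.1 _ _ (ih hΓ hp.2)
  case conjR ih₁ ih₂ => exact conj_iff.2 ⟨ih₁ hΓ hp.1, ih₂ hΓ hp.2⟩
  case limpL ih₁ ih₂ => exact limpL_of_atomic hp.1 (ih₁ hΓ hp.2.1) (ih₂ hΓ hp.2.2)
  case limpR ih => exact limp_iff.2 (ih hΓ hp)
  case impL ih₁ ih₂ => exact impL_of_atomic hp.1 (ih₁ hΓ hp.2.1) (ih₂ hΓ hp.2.2)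
  case impR ih => exact imp_iff.2 (ih (Set.insert_subset_insert hΓ) hp)
  case allL ih => exact allL_of_atomic hp.1 _ _ (ih hΓ hp.2)
  case allR ih => exact all_iff.2 fun t => ih t hΓ (hp t)
  case exR t _ ih => exact ex_iff.2 ⟨t, ih hΓ hp⟩
  case bangR ih => exact bang_iff.2 ⟨rfl, ih hΓ hp⟩
  case oplusR₁ ih => exact oplus_iff.2 (.inl (ih hΓ hp))
  case oplusR₂ ih => exact oplus_iff.2 (.inr (ih hΓ hp))
  case tensorR ih₁ ih₂ => exact tensor_iff.2 ⟨_, _, rfl, ih₁ hΓ hp.1, ih₂ hΓ hp.2⟩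

/-- An inference replacing the bounded clause `B` by the clauses `D`, if it is admissible for
atomic goals under every larger unbounded context, is admissible for all goals. -/
theorem replace_of_atomic {B : PF α T} {D : Multiset (PF α T)} :
    ∀ (G : GF α T) {Γ : Set (PF α T)} {Δ : Multiset (PF α T)},
      (∀ Γ', Γ ⊆ Γ' → ∀ (Δ : Multiset (PF α T)) (G : GF α T), AtomicGoal G →
        UniformlyProvable Γ' (B ::ₘ Δ) G → UniformlyProvable Γ' (D + Δ) G) →
      UniformlyProvable Γ (B ::ₘ Δ) G → UniformlyProvable Γ (D + Δ) G
  | .top, _, _, _, _ => top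
  | .atom _, _, _, H, h => H _ subset_rfl _ _ trivial h
  | .conj G₁ G₂, _, _, H, h =>
    have h := conj_iff.1 h
    conj_iff.2 ⟨replace_of_atomic G₁ H h.1, replace_of_atomic G₂ H h.2⟩
  | .limp C G, _, _, H, h => by
    rw [limp_iff, Multiset.cons_swap] at h
    rw [limp_iff, ← Multiset.add_cons]
    exact replace_of_atomic G H h
  | .imp C G, _, _, H, h =>
    imp_iff.2 (replace_of_atomic G
      (fun Γ' hΓ => H Γ' ((Set.subset_insert _ _).trans hΓ)) (imp_iff.1 h))
  | .all G, _, _, H, h => all_iff.2 fun t => replace_of_atomic (G t) H (all_iff.1 h t)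
  | .ex G, _, _, H, h =>
    have ⟨t, ht⟩ := ex_iff.1 h
    ex_iff.2 ⟨t, replace_of_atomic (G t) H ht⟩
  | .bang _, _, _, _, h => absurd (bang_iff.1 h).1 Multiset.cons_ne_zero
  | .oplus G₁ G₂, _, _, H, h =>
    oplus_iff.2 ((oplus_iff.1 h).imp (replace_of_atomic G₁ H) (replace_of_atomic G₂ H))
  | .tensor G₁ G₂, _, Δ, H, h => by
    obtain ⟨Δ₁, Δ₂, hΔ, h₁, h₂⟩ := tensor_iff.1 h
    have hB : B ∈ Δ₁ + Δ₂ := hΔ ▸ Multiset.mem_cons_self B Δ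
    rcases Multiset.mem_add.1 hB with hB | hB <;> obtain ⟨E, rfl⟩ := Multiset.exists_cons_of_mem hB
    · rw [Multiset.cons_add, Multiset.cons_inj_right] at hΔ
      exact tensor_iff.2 ⟨D + E, Δ₂, by rw [hΔ, add_assoc], replace_of_atomic G₁ H h₁, h₂⟩
    · rw [Multiset.add_cons, Multiset.cons_inj_right] at hΔ
      exact tensor_iff.2 ⟨Δ₁, D + E, by rw [hΔ, add_left_comm], h₁, replace_of_atomic G₂ H h₂⟩

/-- Every provable sequent is uniformly provable. -/
theorem of_proof {G : GF α T} (p : Proof Γ Δ G) : UniformlyProvable Γ Δ G := by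
  induction p with
  | id Γ a => exact id a
  | @absorb Γ Δ G B hB _ ih =>
    rw [← zero_add Δ]
    refine replace_of_atomic G (fun Γ' hΓ Δ G hG h => ?_) ih
    rw [zero_add]
    exact absorb_of_atomic hG (hΓ hB) h
  | topR => exact top
  | @conjL₁ Γ Δ G B₁ B₂ _ ih =>
    exact replace_of_atomic (D := {PF.conj B₁ B₂}) G
      (fun _ _ _ _ hG h => conjL₁_of_atomic hG B₁ B₂ h) ih
  | @conjL₂ Γ Δ G B₁ B₂ _ ih =>
    exact replace_of_atomic (D := {PF.conj B₁ B₂}) G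
      (fun _ _ _ _ hG h => conjL₂_of_atomic hG B₁ B₂ h) ih
  | conjR _ _ ih₁ ih₂ => exact conj_iff.2 ⟨ih₁, ih₂⟩
  | @limpL Γ Δ₁ Δ₂ G G₁ B₂ _ _ ih₁ ih₂ =>
    rw [← Multiset.cons_add]
    refine replace_of_atomic G (fun Γ' hΓ Δ G hG h => ?_) ih₂
    rw [Multiset.cons_add]
    exact limpL_of_atomic hG (ih₁.weaken hΓ) h
  | limpR _ ih => exact limp_iff.2 ih
  | @impL Γ Δ G G₁ B₂ _ _ ih₁ ih₂ =>
    exact replace_of_atomic (D := {PF.imp G₁ B₂}) G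
      (fun _ hΓ _ _ hG h => impL_of_atomic hG (ih₁.weaken hΓ) h) ih₂
  | impR _ ih => exact imp_iff.2 ih
  | @allL Γ Δ G B t _ ih =>
    exact replace_of_atomic (D := {PF.all B}) G
      (fun _ _ _ _ hG h => allL_of_atomic hG B t h) ih
  | allR _ ih => exact all_iff.2 ih
  | exR t _ ih => exact ex_iff.2 ⟨t, ih⟩
  | bangR _ ih => exact bang_iff.2 ⟨rfl, ih⟩
  | oplusR₁ _ ih => exact oplus_iff.2 (.inl ih)
  | oplusR₂ _ ih => exact oplus_iff.2 (.inr ih)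
  | tensorR _ _ ih₁ ih₂ => exact tensor_iff.2 ⟨_, _, rfl, ih₁, ih₂⟩

end UniformlyProvable

/-- **Lolli admits uniform provability**: a Lolli sequent `Γ ; Δ ⊢ G` has a
proof in Lolli if and only if it has a uniform proof. -/
theorem lolli_admits_uniform_provability {α T : Type}
    (Γ : Set (PF α T)) (Δ : Multiset (PF α T)) (G : GF α T) :
    Nonempty (Proof Γ Δ G) ↔ ∃ p : Proof Γ Δ G, Uniform p := by
  exact ⟨fun ⟨p⟩ => UniformlyProvable.of_proof p, fun ⟨p, _⟩ => ⟨p⟩⟩
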